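/- Let E ⊆ ℕA be the exponent set of a monomial ideal and F a face of A such that E has a standard pair belonging to F. Let S = {b ∈ ℕA : b divides some element of a + ℕF for some standard pair (a,F) of E belonging to F whose overlap class is maximal with respect to divisibility}. If b ∈ S and c ∈ ℕA ∖ ℕF, then there is a positive integer k such that b + k·c ∉ S. -/

import Mathlib

open scoped BigOperators

namespace StdPairsPaper

/-- The coercion of a lattice point to a real vector. -/
def toR {d : ℕ} (v : Fin d → ℤ) : Fin d → ℝ := fun i => (v i : ℝ)

/-- The cone of nonnegative real combinations of (the real images of) elements of `S`. -/
def cone {d : ℕ} (S : Set (Fin d → ℤ)) : Set (Fin d → ℝ) :=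
  {x | ∃ (t : Finset (Fin d → ℤ)) (c : (Fin d → ℤ) → ℝ),
    (t : Set (Fin d → ℤ)) ⊆ S ∧ (∀ v, 0 ≤ c v) ∧ x = ∑ v ∈ t, c v • toR v}

/-- `ℕS`, the submonoid of `ℤ^d` generated by `S`. -/
def NSemi {d : ℕ} (S : Set (Fin d → ℤ)) : AddSubmonoid (Fin d → ℤ) :=
  AddSubmonoid.closure S

/-- `ℤS`, the subgroup of `ℤ^d` generated by `S`. -/
def ZGrp {d : ℕ} (S : Set (Fin d → ℤ)) : AddSubgroup (Fin d → ℤ) :=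
  AddSubgroup.closure S

/-- `ℝS`, the real linear span of `S`. -/
def RSpan {d : ℕ} (S : Set (Fin d → ℤ)) : Submodule ℝ (Fin d → ℝ) :=
  Submodule.span ℝ (toR '' S)

/-- `A` is a configuration: a finite set of nonzero lattice points whose `ℤ`-span is `ℤ^d`
and whose nonnegative real cone is strongly convex (contains no line, i.e. is pointed). -/
structure IsConfig {d : ℕ} (A : Set (Fin d → ℤ)) : Prop where
  (finite : A.Finite)
  (nonzero : (0 : Fin d → ℤ) ∉ A)
  (spans : ZGrp A = ⊤)
  (pointed : ∀ x ∈ cone A, -x ∈ cone A → x = 0)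

/-- `F` is a face of the configuration `A`: `F ⊆ A`, the cone over `F` is an extreme
subset (face) of the cone over `A`, and `ℝ_{≥0}F ∩ A = F`. -/
def IsFace {d : ℕ} (A F : Set (Fin d → ℤ)) : Prop :=
  F ⊆ A ∧ IsExtreme ℝ (cone A) (cone F) ∧ cone F ∩ (toR '' A) = toR '' F

/-- The set `a + ℕF`. -/
def cell {d : ℕ} (a : Fin d → ℤ) (F : Set (Fin d → ℤ)) : Set (Fin d → ℤ) :=
  {x | ∃ f ∈ NSemi F, x = a + f}

/-- Two pairs `(a,F)` and `(b,F)` belonging to the same face `F` overlap: `a - b ∈ ℤF`. -/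
def Overlap {d : ℕ} (F : Set (Fin d → ℤ)) (a b : Fin d → ℤ) : Prop :=
  a - b ∈ ZGrp F

/-- The pair `(a,F)` divides the pair `(b,G)`:
there is `c ∈ ℕA` with `a + c + ℕF ⊆ b + ℕG`. -/
def PairDvd {d : ℕ} (A : Set (Fin d → ℤ)) (a : Fin d → ℤ) (F : Set (Fin d → ℤ))
    (b : Fin d → ℤ) (G : Set (Fin d → ℤ)) : Prop :=
  ∃ c ∈ NSemi A, cell (a + c) F ⊆ cell b G

/-- `E` is the exponent set of a monomial ideal of `ℕA`: `E ⊆ ℕA` and `E + ℕA ⊆ E`. -/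
def IsExpSet {d : ℕ} (A E : Set (Fin d → ℤ)) : Prop :=
  E ⊆ (NSemi A : Set (Fin d → ℤ)) ∧ ∀ e ∈ E, ∀ c ∈ NSemi A, e + c ∈ E

/-- The standard monomials of `E`: `ℕA ∖ E`. -/
def stdSet {d : ℕ} (A E : Set (Fin d → ℤ)) : Set (Fin d → ℤ) :=
  (NSemi A : Set (Fin d → ℤ)) \ E

/-- `(a,F)` is a proper pair of `E`: a pair of `A` with `a + ℕF ⊆ std(E)`. -/
def ProperPair {d : ℕ} (A E : Set (Fin d → ℤ)) (a : Fin d → ℤ)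
    (F : Set (Fin d → ℤ)) : Prop :=
  a ∈ NSemi A ∧ IsFace A F ∧ cell a F ⊆ stdSet A E

/-- `(a,F)` is a standard pair of `E`: a proper pair of `E` maximal with respect to
the partial order `(a,F) ≼ (b,G) ↔ a + ℕF ⊆ b + ℕG`. -/
def StdPair {d : ℕ} (A E : Set (Fin d → ℤ)) (a : Fin d → ℤ)
    (F : Set (Fin d → ℤ)) : Prop :=
  ProperPair A E a F ∧
    ∀ b G, ProperPair A E b G → cell a F ⊆ cell b G → cell b G ⊆ cell a F

/-- The overlap class of the standard pair `(a,F)` of `E` is maximal with respect to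
divisibility among overlap classes of standard pairs of `E`. -/
def MaxClass {d : ℕ} (A E : Set (Fin d → ℤ)) (a : Fin d → ℤ)
    (F : Set (Fin d → ℤ)) : Prop :=
  ∀ b G, StdPair A E b G → PairDvd A a F b G → PairDvd A b G a F

noncomputable section

/-- The affine semigroup ring `k[ℕA]`. -/
abbrev SGRing {d : ℕ} (k : Type*) [Field k] (A : Set (Fin d → ℤ)) :=
  AddMonoidAlgebra k (NSemi A)

/-- The monomial `t^a` of `k[ℕA]`. -/
def mono {d : ℕ} (k : Type*) [Field k] (A : Set (Fin d → ℤ)) (a : (NSemi A)) :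
    SGRing k A :=
  AddMonoidAlgebra.single a 1

/-- `I` is a monomial ideal of `k[ℕA]`: an ideal generated by monomials. -/
def IsMonomialIdeal {d : ℕ} (k : Type*) [Field k] (A : Set (Fin d → ℤ))
    (I : Ideal (SGRing k A)) : Prop :=
  ∃ S : Set (NSemi A), I = Ideal.span ((fun a => mono k A a) '' S)

/-- The exponent set `E(I) = {a ∈ ℕA : t^a ∈ I}` of an ideal of `k[ℕA]`,
as a subset of `ℤ^d`. -/
def expSet {d : ℕ} (k : Type*) [Field k] (A : Set (Fin d → ℤ))
    (I : Ideal (SGRing k A)) : Set (Fin d → ℤ) :=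
  {x | ∃ h : x ∈ NSemi A, mono k A ⟨x, h⟩ ∈ I}

/-- The monomial prime ideal `p_F = ⟨t^a : a ∈ ℕA ∖ ℕF⟩` of `k[ℕA]`. -/
def primeF {d : ℕ} (k : Type*) [Field k] (A F : Set (Fin d → ℤ)) :
    Ideal (SGRing k A) :=
  Ideal.span {x | ∃ a : (NSemi A), (a : Fin d → ℤ) ∉ NSemi F ∧ x = mono k A a}

end


/-- There are `ℚ`-linear functionals on `ℝ` that are positive on a given finite set of positive
reals. -/
lemma exists_linearMap_pos (s : Finset ℝ) (hs : ∀ p ∈ s, 0 < p) :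
    ∃ f : ℝ →ₗ[ℚ] ℚ, ∀ p ∈ s, 0 < f p := by
  classical
  let B := Module.Basis.ofVectorSpace ℚ ℝ
  have hr : ∀ x : ℝ, ∃ r : ℕ → ℚ, Filter.Tendsto (fun n => (r n : ℝ)) Filter.atTop (nhds x) := by
    intro x
    choose r hr₁ hr₂ using fun n : ℕ =>
      exists_rat_btwn (show x < x + 1 / ((n : ℝ) + 1) by
        have : 0 < 1 / ((n : ℝ) + 1) := by positivity
        linarith)
    refine ⟨r, tendsto_of_tendsto_of_tendsto_of_le_of_le tendsto_const_nhds ?_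
      (fun n => (hr₁ n).le) (fun n => (hr₂ n).le)⟩
    simpa using tendsto_const_nhds.add (tendsto_one_div_add_atTop_nhds_zero_nat (𝕜 := ℝ))
  choose r hr using hr
  let f : ℕ → ℝ →ₗ[ℚ] ℚ := fun n => B.constr ℚ fun i => r (B i) n
  have hf : ∀ p : ℝ, Filter.Tendsto (fun n => (f n p : ℝ)) Filter.atTop (nhds p) := by
    intro p
    have h₁ : ∀ n, (f n p : ℝ) = ∑ i ∈ (B.repr p).support, (B.repr p i : ℝ) * (r (B i) n : ℝ) := by
      intro n
      simp [f, Module.Basis.constr_apply, Finsupp.sum]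
    have h₂ : p = ∑ i ∈ (B.repr p).support, (B.repr p i : ℝ) * B i := by
      conv_lhs => rw [← B.linearCombination_repr p, Finsupp.linearCombination_apply, Finsupp.sum]
      simp [Rat.smul_def]
    simp only [h₁]
    conv => arg 3; rw [h₂]
    exact tendsto_finsetSum _ fun i _ => (hr (B i)).const_mul _
  have hev : ∀ᶠ n in Filter.atTop, ∀ p ∈ s, (0 : ℝ) < f n p :=
    (Filter.eventually_all_finset s).2 fun p hp => (hf p).eventually_const_lt (hs p hp)
  obtain ⟨n, hn⟩ := hev.exists
  exact ⟨f n, fun p hp => by exact_mod_cast hn p hp⟩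

/-- There are additive functionals on `ℝ` taking natural number values on a given finite set of
nonnegative reals, positive on its positive elements. -/
lemma exists_addMonoidHom_nat (s : Finset ℝ) (hs : ∀ p ∈ s, 0 ≤ p) :
    ∃ f : ℝ →+ ℚ, ∀ p ∈ s, ∃ n : ℕ, f p = n ∧ (0 < p → 0 < n) := by
  classical
  obtain ⟨g, hg⟩ := exists_linearMap_pos (s.filter (0 < ·)) (by simp)
  let N : ℕ := ∏ p ∈ s, (g p).den
  have hN : 0 < N := Finset.prod_pos fun p _ => (g p).den_pos
  refine ⟨((N : ℚ) • g).toAddMonoidHom, fun p hp => ?_⟩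
  obtain ⟨k, hk⟩ : (g p).den ∣ N := Finset.dvd_prod_of_mem _ hp
  have hval : (N : ℚ) * g p = ((k * (g p).num : ℤ) : ℚ) := by
    rw [hk]
    push_cast
    rw [mul_comm ((g p).den : ℚ), mul_assoc, Rat.den_mul_eq_num]
  have hnn : 0 ≤ g p := by
    rcases (hs p hp).eq_or_lt with h | h
    · simp [← h]
    · exact (hg p (by simp [hp, h])).le
  have hnum : 0 ≤ (k * (g p).num : ℤ) := by
    have := Rat.num_nonneg.2 hnn
    positivity
  obtain ⟨n, hn⟩ := Int.eq_ofNat_of_zero_le hnum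
  rw [hn] at hval
  refine ⟨n, by simpa using hval, fun h => ?_⟩
  have h₁ : 0 < (N : ℚ) * g p := mul_pos (by exact_mod_cast hN) (hg p (by simp [hp, h]))
  rw [hval] at h₁
  exact_mod_cast h₁

lemma nsmul_sum_mem_NSemi {d : ℕ} {S : Set (Fin d → ℤ)} {t : Finset (Fin d → ℤ)}
    (ht : (t : Set (Fin d → ℤ)) ⊆ S) (n : (Fin d → ℤ) → ℕ) : ∑ v ∈ t, n v • v ∈ NSemi S :=
  sum_mem fun v hv => nsmul_mem (AddSubmonoid.subset_closure (ht hv)) (n v)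

/-- A real conic relation involving a lattice vector `v` with positive coefficient can be replaced
by an integral one. -/
lemma exists_nsmul_add_mem_NSemi {d : ℕ} {A F : Set (Fin d → ℤ)} {v : Fin d → ℤ} {r : ℝ}
    (hr : 0 < r) {u : Fin d → ℝ} (hu : u ∈ cone A) (h : r • toR v + u ∈ cone F) :
    ∃ n : ℕ, 0 < n ∧ ∃ w ∈ NSemi A, n • v + w ∈ NSemi F := by
  classical
  obtain ⟨t, c, ht, hc, rfl⟩ := hu
  obtain ⟨t', c', ht', hc', h⟩ := h
  obtain ⟨f, hf⟩ := exists_addMonoidHom_nat (insert r (t.image c ∪ t'.image c')) (by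
    intro p hp
    simp only [Finset.mem_insert, Finset.mem_union, Finset.mem_image] at hp
    rcases hp with rfl | ⟨x, -, rfl⟩ | ⟨x, -, rfl⟩
    exacts [hr.le, hc x, hc' x])
  choose! n hn hn' using hf
  have hmul : ∀ (x : ℝ) (k : ℤ), f (x * k) = f x * k := by
    intro x k
    rw [mul_comm, ← zsmul_eq_mul, map_zsmul, zsmul_eq_mul, mul_comm]
  refine ⟨n r, hn' r (by simp) hr, ∑ a ∈ t, n (c a) • a,
    nsmul_sum_mem_NSemi ht fun a => n (c a), ?_⟩
  have key : n r • v + ∑ a ∈ t, n (c a) • a = ∑ a ∈ t', n (c' a) • a := by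
    funext i
    have hi := congrArg f (congrFun h i)
    simp only [toR, Pi.add_apply, Pi.smul_apply, Finset.sum_apply, smul_eq_mul, map_add, map_sum,
      hmul] at hi
    rw [hn r (by simp),
      Finset.sum_congr rfl fun a ha => by
        rw [hn (c a) (by simp only [Finset.mem_insert, Finset.mem_union, Finset.mem_image]
                         exact Or.inr (Or.inl ⟨a, ha, rfl⟩))],
      Finset.sum_congr (s₁ := t') rfl fun a ha => by
        rw [hn (c' a) (by simp only [Finset.mem_insert, Finset.mem_union, Finset.mem_image]
                          exact Or.inr (Or.inr ⟨a, ha, rfl⟩))]] at hi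
    simp only [Pi.add_apply, Finset.sum_apply, nsmul_eq_mul]
    exact_mod_cast hi
  rw [key]
  exact nsmul_sum_mem_NSemi ht' fun a => n (c' a)

lemma add_mem_cone {d : ℕ} {S : Set (Fin d → ℤ)} {x y : Fin d → ℝ} (hx : x ∈ cone S)
    (hy : y ∈ cone S) : x + y ∈ cone S := by
  classical
  obtain ⟨t, c, ht, hc, rfl⟩ := hx
  obtain ⟨t', c', ht', hc', rfl⟩ := hy
  refine ⟨t ∪ t', fun v => (if v ∈ t then c v else 0) + (if v ∈ t' then c' v else 0),
    by simpa using ⟨ht, ht'⟩, fun v => ?_, ?_⟩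
  · have h := hc v
    have h' := hc' v
    positivity
  · simp only [add_smul, Finset.sum_add_distrib, ite_smul, zero_smul, Finset.sum_ite_mem]
    congr 1 <;> congr 1 <;> ext <;> simp +contextual

lemma smul_mem_cone {d : ℕ} {S : Set (Fin d → ℤ)} {x : Fin d → ℝ} (hx : x ∈ cone S) {r : ℝ}
    (hr : 0 ≤ r) : r • x ∈ cone S := by
  obtain ⟨t, c, ht, hc, rfl⟩ := hx
  exact ⟨t, fun v => r * c v, ht, fun v => mul_nonneg hr (hc v), by simp [Finset.smul_sum, mul_smul]⟩

lemma cone_mono {d : ℕ} {S T : Set (Fin d → ℤ)} (h : S ⊆ T) : cone S ⊆ cone T := by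
  rintro x ⟨t, c, ht, hc, rfl⟩
  exact ⟨t, c, ht.trans h, hc, rfl⟩

lemma toR_mem_cone {d : ℕ} {S : Set (Fin d → ℤ)} {v : Fin d → ℤ} (hv : v ∈ S) :
    toR v ∈ cone S :=
  ⟨{v}, fun _ => 1, by simpa using hv, by simp, by simp⟩

/-- The generators in `A` dividing, in `ℕA`, some element of `ℕS`. -/
def faceHull {d : ℕ} (A S : Set (Fin d → ℤ)) : Set (Fin d → ℤ) :=
  {v | v ∈ A ∧ ∃ u ∈ NSemi A, v + u ∈ NSemi S}

lemma exists_add_mem_of_mem_NSemi_faceHull {d : ℕ} {A S : Set (Fin d → ℤ)} {x : Fin d → ℤ}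
    (hx : x ∈ NSemi (faceHull A S)) : ∃ u ∈ NSemi A, x + u ∈ NSemi S := by
  induction hx using AddSubmonoid.closure_induction with
  | mem x hx => exact hx.2
  | zero => exact ⟨0, zero_mem _, by simp⟩
  | add x y _ _ hx hy =>
    obtain ⟨u, hu, hxu⟩ := hx
    obtain ⟨w, hw, hyw⟩ := hy
    exact ⟨u + w, add_mem hu hw, by rw [add_add_add_comm]; exact add_mem hxu hyw⟩

lemma mem_faceHull_of_smul_add_mem_cone {d : ℕ} {A S : Set (Fin d → ℤ)} {v : Fin d → ℤ}
    (hv : v ∈ A) {r : ℝ} (hr : 0 < r) {u : Fin d → ℝ} (hu : u ∈ cone A)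
    (h : r • toR v + u ∈ cone (faceHull A S)) : v ∈ faceHull A S := by
  obtain ⟨n, hn, w, hw, hnw⟩ := exists_nsmul_add_mem_NSemi hr hu h
  obtain ⟨z, hz, hwz⟩ := exists_add_mem_of_mem_NSemi_faceHull hnw
  obtain ⟨k, rfl⟩ := Nat.exists_eq_add_of_lt hn
  refine ⟨hv, k • v + w + z,
    add_mem (add_mem (nsmul_mem (AddSubmonoid.subset_closure hv) _) hw) hz, ?_⟩
  convert hwz using 1
  rw [zero_add, add_smul, one_smul]
  abel

lemma isFace_faceHull {d : ℕ} (A S : Set (Fin d → ℤ)) : IsFace A (faceHull A S) := by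
  classical
  have hsub : faceHull A S ⊆ A := fun v hv => hv.1
  have hzero : (0 : Fin d → ℝ) ∈ cone A := ⟨∅, 0, by simp, by simp, by simp⟩
  refine ⟨hsub, ⟨cone_mono hsub, ?_⟩, ?_⟩
  · rintro x ⟨t, c, ht, hc, rfl⟩ y hy z hz ⟨p, q, hp, hq, -, rfl⟩
    refine ⟨t.filter (0 < c ·), c, ?_, hc, ?_⟩
    · intro v hv
      simp only [Finset.coe_filter, Set.mem_ofPred_eq] at hv
      refine mem_faceHull_of_smul_add_mem_cone (ht hv.1) (mul_pos hp hv.2)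
        (u := p • ∑ a ∈ t.erase v, c a • toR a + q • y)
        (add_mem_cone (smul_mem_cone ⟨t.erase v, c, ?_, hc, rfl⟩ hp.le)
          (smul_mem_cone hy hq.le)) ?_
      · exact fun a ha => ht (Finset.mem_of_mem_erase ha)
      · convert hz using 1
        rw [← Finset.add_sum_erase t _ hv.1, smul_add, mul_smul, add_assoc]
    · refine (Finset.sum_filter_of_ne fun v _ h => ?_).symm
      exact (hc v).lt_of_ne fun h0 => h (by rw [← h0, zero_smul])
  · ext x
    constructor
    · rintro ⟨hx, v, hv, rfl⟩
      exact ⟨v, mem_faceHull_of_smul_add_mem_cone hv one_pos hzero (by simpa using hx), rfl⟩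
    · rintro ⟨v, hv, rfl⟩
      exact ⟨toR_mem_cone hv, v, hv.1, rfl⟩

lemma subset_faceHull {d : ℕ} {A S : Set (Fin d → ℤ)} {v : Fin d → ℤ} (hv : v ∈ A)
    (hvS : v ∈ S) : v ∈ faceHull A S :=
  ⟨hv, 0, zero_mem _, (add_zero v).symm ▸ AddSubmonoid.subset_closure hvS⟩

lemma mem_NSemi_faceHull {d : ℕ} {A S : Set (Fin d → ℤ)} {x u : Fin d → ℤ} (hx : x ∈ NSemi A)
    (hu : u ∈ NSemi A) (h : x + u ∈ NSemi S) : x ∈ NSemi (faceHull A S) := by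
  induction hx using AddSubmonoid.closure_induction generalizing u with
  | mem x hx => exact AddSubmonoid.subset_closure ⟨hx, u, hu, h⟩
  | zero => exact zero_mem _
  | add x y hx hy ihx ihy =>
    refine add_mem (ihx (add_mem hy hu) (by rwa [← add_assoc])) (ihy (add_mem hx hu) ?_)
    convert h using 1
    abel

/-- Dickson's lemma in a finitely generated monoid: a sequence in `ℕA` has a subsequence that is
a chain for divisibility. -/
lemma exists_dvd_subseq {d : ℕ} {A : Set (Fin d → ℤ)} (hA : A.Finite) (u : ℕ → Fin d → ℤ)
    (hu : ∀ n, u n ∈ NSemi A) :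
    ∃ g : ℕ → ℕ, StrictMono g ∧ ∀ m n, m ≤ n → u (g n) - u (g m) ∈ NSemi A := by
  have := hA.fintype
  have hlift : ∀ n, ∃ c : A → ℕ, ∑ i, c i • (i : Fin d → ℤ) = u n := by
    intro n
    rw [← Submodule.mem_span_range_iff_exists_fun ℕ, Subtype.range_coe, ← Submodule.mem_toAddSubmonoid,
      Submodule.span_nat_eq_addSubmonoidClosure]
    exact hu n
  choose c hc using hlift
  obtain ⟨g, hg⟩ := (wellQuasiOrdered_le (α := A → ℕ)).exists_monotone_subseq c
  refine ⟨g, g.strictMono, fun m n hmn => ?_⟩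
  have : u (g n) - u (g m) = ∑ i, (c (g n) i - c (g m) i) • (i : Fin d → ℤ) := by
    rw [← hc, ← hc, ← Finset.sum_sub_distrib]
    refine Finset.sum_congr rfl fun i _ => ?_
    rw [sub_nsmul _ (hg m n hmn i), sub_eq_add_neg]
  rw [this]
  exact sum_mem fun i _ => nsmul_mem (AddSubmonoid.subset_closure i.2) _

lemma mem_stdSet_of_add_mem {d : ℕ} {A E : Set (Fin d → ℤ)} (hE : IsExpSet A E) {x u : Fin d → ℤ}
    (hx : x ∈ NSemi A) (hu : u ∈ NSemi A) (h : x + u ∈ stdSet A E) : x ∈ stdSet A E :=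
  ⟨hx, fun hxE => h.2 (hE.2 x hxE u hu)⟩

/-- With `S` the set of elements of `ℕA` dividing some element of
`a + ℕF` for some standard pair `(a,F)` of `E` whose overlap class is maximal with
respect to divisibility: if `b ∈ S` and `c ∈ ℕA ∖ ℕF`, then there is a positive
integer `m` with `b + m • c ∉ S`. -/
theorem escape_from_S {d : ℕ} (A : Set (Fin d → ℤ)) (hA : IsConfig A)
    (E : Set (Fin d → ℤ)) (hE : IsExpSet A E)
    (F : Set (Fin d → ℤ)) (hF : IsFace A F) (hex : ∃ a, StdPair A E a F)
    (b : Fin d → ℤ)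
    (hb : b ∈ NSemi A ∧ ∃ a, StdPair A E a F ∧ MaxClass A E a F ∧
      ∃ y ∈ cell a F, y - b ∈ NSemi A)
    (c : Fin d → ℤ) (hc : c ∈ NSemi A) (hcF : c ∉ NSemi F) :
    ∃ m : ℕ, 0 < m ∧
      ¬ (b + m • c ∈ NSemi A ∧ ∃ a, StdPair A E a F ∧ MaxClass A E a F ∧
        ∃ y ∈ cell a F, y - (b + m • c) ∈ NSemi A) := by
  by_contra! hS
  choose _ a ha _ y hy hu using fun n : ℕ => hS (n + 1) n.succ_pos
  choose f hf hyf using hy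
  obtain ⟨g, hg, hchain⟩ := exists_dvd_subseq hA.finite _ hu
  have hFA : NSemi F ≤ NSemi A := AddSubmonoid.closure_mono hF.1
  have haA := (ha (g 0)).1.1
  have hproper : ProperPair A E (a (g 0)) (faceHull A (insert c F)) := by
    refine ⟨haA, isFace_faceHull _ _, ?_⟩
    rintro _ ⟨h, hh, rfl⟩
    obtain ⟨u, huA, hmem⟩ := exists_add_mem_of_mem_NSemi_faceHull hh
    obtain ⟨k, f', hf', hk⟩ : ∃ k : ℕ, ∃ f' ∈ NSemi F, k • c + f' = h + u := by
      rw [NSemi, Set.insert_eq, AddSubmonoid.closure_union, AddSubmonoid.mem_sup] at hmem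
      obtain ⟨z, hz, f', hf', hzf⟩ := hmem
      obtain ⟨k, rfl⟩ := AddSubmonoid.mem_closure_singleton.1 hz
      exact ⟨k, f', hf', hzf⟩
    have hhA : h ∈ NSemi A := AddSubmonoid.closure_mono (fun v hv => hv.1) hh
    have hgk : g 0 + k ≤ g k := by
      have := hg.add_le_nat k 0
      simpa [add_comm] using this
    obtain ⟨l, hl⟩ := Nat.exists_eq_add_of_le hgk
    refine mem_stdSet_of_add_mem hE (add_mem haA hhA)
      (add_mem (add_mem huA (hFA (hf (g 0))))
        (add_mem (hchain 0 k k.zero_le) (nsmul_mem hc l))) ?_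
    have hend : a (g k) + (f (g k) + f') ∈ stdSet A E :=
      (ha (g k)).1.2.2 ⟨_, add_mem (hf (g k)) hf', rfl⟩
    convert hend using 1
    have h₀ := hyf (g 0)
    have h₁ := hyf (g k)
    rw [h₀, h₁, hl, eq_sub_of_add_eq hk.symm]
    module
  have hle : NSemi F ≤ NSemi (faceHull A (insert c F)) :=
    AddSubmonoid.closure_mono fun v hv => subset_faceHull (hF.1 hv) (Set.mem_insert_of_mem _ hv)
  have hcH : c ∈ NSemi (faceHull A (insert c F)) :=
    mem_NSemi_faceHull hc (zero_mem _)
      ((add_zero c).symm ▸ AddSubmonoid.subset_closure (Set.mem_insert c F))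
  obtain ⟨f', hf', heq⟩ := (ha (g 0)).2 _ _ hproper
    (by rintro _ ⟨z, hz, rfl⟩; exact ⟨z, hle hz, rfl⟩) ⟨c, hcH, rfl⟩
  exact hcF (add_left_cancel heq ▸ hf')

end StdPairsPaper
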